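/- arXiv:1904.06366 — 5 statements merged into one kernel-verified Lean document; each statement's English description precedes it below -/
import Mathlib

section
/- Let V be a real p×q matrix with singular value decomposition V = P Λ Qᵀ, where P is p×q with PᵀP = I_q, Q is a q×q orthogonal matrix, and Λ is a q×q diagonal matrix with nonnegative diagonal entries. Then for every real p×q matrix W with WᵀW = I_q, trace(WᵀV) ≤ trace(Λ), and equality is attained at W = P Qᵀ. -/
open Matrix BigOperators

/-- The diagonal entries of `Aᵀ * B` are at most `1` when the columns of `A` and `B` are unit
vectors. -/
theorem transpose_mul_apply_self_le_one {m n : Type*} [Fintype m]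
    {A B : Matrix m n ℝ} (hA : ∀ i, ∑ k, A k i * A k i = 1) (hB : ∀ i, ∑ k, B k i * B k i = 1)
    (i : n) : (Aᵀ * B) i i ≤ 1 := by
  have h : 2 * ∑ k, A k i * B k i ≤ ∑ k, A k i * A k i + ∑ k, B k i * B k i := by
    rw [Finset.mul_sum, ← Finset.sum_add_distrib]
    exact Finset.sum_le_sum fun k _ => by nlinarith [sq_nonneg (A k i - B k i)]
  rw [hA, hB] at h
  simp only [mul_apply, transpose_apply]
  linarith

/-- The columns of a matrix with `Aᵀ * A = 1` are unit vectors. -/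
theorem sum_mul_self_eq_one_of_transpose_mul_self {m n : Type*} [Fintype m] [DecidableEq n]
    {A : Matrix m n ℝ} (hA : Aᵀ * A = 1) (i : n) : ∑ k, A k i * A k i = 1 := by
  simpa [mul_apply] using congrFun (congrFun hA i) i

/-- Multiplying by a nonnegative diagonal matrix a matrix whose diagonal entries are at most `1`
gives a trace at most that of the diagonal matrix. -/
theorem trace_mul_le_trace_of_isDiag {n : Type*} [Fintype n] {M D : Matrix n n ℝ}
    (hM : ∀ i, M i i ≤ 1) (hD : D.IsDiag) (hnn : ∀ i, 0 ≤ D i i) :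
    (M * D).trace ≤ D.trace := by
  refine Finset.sum_le_sum fun i _ => ?_
  rw [diag_apply, diag_apply, mul_apply,
    Finset.sum_eq_single i (fun j _ hj => by rw [hD hj, mul_zero]) (by simp)]
  exact mul_le_of_le_one_left (hnn i) (hM i)

/-- Let `V = P Λ Qᵀ` be a singular value decomposition of a real `p×q` matrix `V`, where
`P` is `p×q` with orthonormal columns, `Q` is `q×q` orthogonal, and `Λ` is diagonal with
nonnegative entries. Then for every `p×q` matrix `W` with orthonormal columns,
`trace(Wᵀ V) ≤ trace(Λ)`, with equality attained at `W = P Qᵀ`. -/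
theorem trace_le_trace_singular_values (p q : ℕ)
    (V P : Matrix (Fin p) (Fin q) ℝ) (Q Λ : Matrix (Fin q) (Fin q) ℝ)
    (hP : Pᵀ * P = 1) (hQ : Qᵀ * Q = 1)
    (hdiag : Λ.IsDiag) (hnn : ∀ i, 0 ≤ Λ i i)
    (hV : V = P * Λ * Qᵀ) :
    (∀ W : Matrix (Fin p) (Fin q) ℝ, Wᵀ * W = 1 → (Wᵀ * V).trace ≤ Λ.trace) ∧
    ((P * Qᵀ)ᵀ * V).trace = Λ.trace := by
  have key (W : Matrix (Fin p) (Fin q) ℝ) : (Wᵀ * V).trace = ((W * Q)ᵀ * P * Λ).trace := by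
    rw [hV, ← Matrix.mul_assoc, trace_mul_comm, transpose_mul]
    simp only [Matrix.mul_assoc]
  refine ⟨fun W hW => ?_, ?_⟩
  · have hWQ : (W * Q)ᵀ * (W * Q) = 1 := by
      rw [transpose_mul, Matrix.mul_assoc, ← Matrix.mul_assoc Wᵀ, hW, Matrix.one_mul, hQ]
    rw [key]
    exact trace_mul_le_trace_of_isDiag
      (transpose_mul_apply_self_le_one (sum_mul_self_eq_one_of_transpose_mul_self hWQ)
        (sum_mul_self_eq_one_of_transpose_mul_self hP)) hdiag hnn
  · rw [key, Matrix.mul_assoc P, hQ, Matrix.mul_one, hP, Matrix.one_mul]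
end

section
/- Let V_1, …, V_m be real p×q matrices with V_jᵀV_j = I_q for every j, let V = ∑_{j=1}^m V_j, and suppose V = P Λ Qᵀ is a singular value decomposition, where P is p×q with PᵀP = I_q, Q is a q×q orthogonal matrix, and Λ is a q×q diagonal matrix with nonnegative diagonal entries. Then W = P Qᵀ satisfies WᵀW = I_q and minimizes ∑_{j=1}^m ‖W − V_j‖_F² over all real p×q matrices W with WᵀW = I_q. -/
open Matrix BigOperators

namespace Matrix

variable {m n ι : Type*} [Fintype m] [DecidableEq n]

/-- Corresponding columns of two matrices with orthonormal columns have inner product at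
most one. -/
theorem transpose_mul_apply_self_le_one {A B : Matrix m n ℝ} (hA : Aᵀ * A = 1)
    (hB : Bᵀ * B = 1) (i : n) : (Aᵀ * B) i i ≤ 1 := by
  have hA' : ∑ k, A k i * A k i = 1 := by simpa [mul_apply] using congrFun₂ hA i i
  have hB' : ∑ k, B k i * B k i = 1 := by simpa [mul_apply] using congrFun₂ hB i i
  have h : 2 * (Aᵀ * B) i i ≤ ∑ k, A k i * A k i + ∑ k, B k i * B k i := by
    simp only [mul_apply, transpose_apply, Finset.mul_sum, ← Finset.sum_add_distrib]
    exact Finset.sum_le_sum fun k _ => by nlinarith [sq_nonneg (A k i - B k i)]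
  linarith

variable [Fintype n]

/-- For a nonnegative diagonal matrix `D`, the trace of `AᵀBD` with `A`, `B` having orthonormal
columns is at most the trace of `D`. -/
theorem trace_transpose_mul_mul_isDiag_le {A B : Matrix m n ℝ} (hA : Aᵀ * A = 1)
    (hB : Bᵀ * B = 1) {D : Matrix n n ℝ} (hD : D.IsDiag) (hnn : ∀ i, 0 ≤ D i i) :
    (Aᵀ * B * D).trace ≤ D.trace := by
  rw [← hD.diagonal_diag]
  simp only [trace, diag_apply, mul_diagonal, diagonal_apply_eq]
  exact Finset.sum_le_sum fun i _ =>
    mul_le_of_le_one_left (hnn i) (transpose_mul_apply_self_le_one hA hB i)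

/-- The sum of squared Frobenius distances from a matrix with orthonormal columns to a finite
family depends on that matrix only through its inner product with the sum of the family. -/
theorem sum_trace_transpose_sub_mul_sub [Fintype ι] (V : ι → Matrix m n ℝ) {W : Matrix m n ℝ}
    (hW : Wᵀ * W = 1) :
    ∑ j, ((W - V j)ᵀ * (W - V j)).trace =
      ∑ j, ((1 : Matrix n n ℝ).trace + ((V j)ᵀ * V j).trace) - 2 * (Wᵀ * ∑ j, V j).trace := by
  rw [Matrix.mul_sum, trace_sum, Finset.mul_sum, ← Finset.sum_sub_distrib]
  refine Finset.sum_congr rfl fun j _ => ?_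
  have h : ((V j)ᵀ * W).trace = (Wᵀ * V j).trace := by
    rw [← trace_transpose, transpose_mul, transpose_transpose]
  simp only [transpose_sub, Matrix.sub_mul, Matrix.mul_sub, trace_sub, hW, h]
  ring

/-- Right multiplication by an orthogonal matrix preserves orthonormality of columns. -/
theorem transpose_mul_self_mul_eq_one {A : Matrix m n ℝ} {Q : Matrix n n ℝ} (hA : Aᵀ * A = 1)
    (hQ : Qᵀ * Q = 1) : (A * Q)ᵀ * (A * Q) = 1 := by
  rw [transpose_mul, Matrix.mul_assoc, ← Matrix.mul_assoc Aᵀ, hA, Matrix.one_mul, hQ]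

end Matrix

/-- Let `V_1, …, V_m` be real `p×q` matrices with orthonormal columns, `V = ∑_j V_j`, and
let `V = P Λ Qᵀ` be a singular value decomposition (`P` `p×q` with orthonormal columns,
`Q` `q×q` orthogonal, `Λ` diagonal with nonnegative entries). Then `W = P Qᵀ` has
orthonormal columns and minimizes `∑_j ‖W − V_j‖_F²` (with `‖A‖_F² = trace(AᵀA)`) over all
`p×q` matrices with orthonormal columns. -/
theorem nearest_orthonormal_matrix (p q m : ℕ)
    (V : Fin m → Matrix (Fin p) (Fin q) ℝ) (hV : ∀ j, (V j)ᵀ * (V j) = 1)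
    (P : Matrix (Fin p) (Fin q) ℝ) (Q Λ : Matrix (Fin q) (Fin q) ℝ)
    (hP : Pᵀ * P = 1) (hQ : Qᵀ * Q = 1)
    (hdiag : Λ.IsDiag) (hnn : ∀ i, 0 ≤ Λ i i)
    (hSVD : ∑ j, V j = P * Λ * Qᵀ) :
    ((P * Qᵀ)ᵀ * (P * Qᵀ) = 1) ∧
    ∀ W : Matrix (Fin p) (Fin q) ℝ, Wᵀ * W = 1 →
      ∑ j, ((P * Qᵀ - V j)ᵀ * (P * Qᵀ - V j)).trace
        ≤ ∑ j, ((W - V j)ᵀ * (W - V j)).trace := by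
  have hPQ : (P * Qᵀ)ᵀ * (P * Qᵀ) = 1 :=
    transpose_mul_self_mul_eq_one hP (by rw [transpose_transpose, mul_eq_one_comm, hQ])
  refine ⟨hPQ, fun W hW => ?_⟩
  have hcycle (X : Matrix (Fin p) (Fin q) ℝ) :
      (Xᵀ * (P * Λ * Qᵀ)).trace = ((X * Q)ᵀ * P * Λ).trace := by
    rw [← Matrix.mul_assoc, trace_mul_comm, transpose_mul]
    simp only [Matrix.mul_assoc]
  rw [sum_trace_transpose_sub_mul_sub V hPQ, sum_trace_transpose_sub_mul_sub V hW, hSVD,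
    hcycle, hcycle, Matrix.mul_assoc P, hQ, Matrix.mul_one, hP, Matrix.one_mul]
  have := trace_transpose_mul_mul_isDiag_le (transpose_mul_self_mul_eq_one hW hQ) hP hdiag hnn
  linarith
end

section
/- Let Y be a real-valued random variable on a probability space (Ω, P) with cumulative distribution function F, and let V be uniform on [0,1] and independent of Y. Then the generalized distributional transform U = F(Y−) + V·(F(Y) − F(Y−)) is uniformly distributed on [0,1]. -/
open MeasureTheory ProbabilityTheory

open Filter Topology Set in
/-- Every level `u ∈ (0, 1)` has a quantile. -/
theorem exists_quantile (μ : Measure ℝ) [IsProbabilityMeasure μ] {u : ℝ}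
    (hu0 : 0 < u) (hu1 : u < 1) :
    ∃ q, (∀ y < q, μ.real (Iic y) < u) ∧ μ.real (Iio q) ≤ u ∧ u ≤ μ.real (Iic q) := by
  set S : Set ℝ := {y | u ≤ cdf μ y} with hS
  have hne : S.Nonempty := ((tendsto_cdf_atTop μ).eventually_const_le hu1).exists
  obtain ⟨b, hb⟩ := ((tendsto_cdf_atBot μ).eventually_lt_const hu0).exists
  have hbdd : BddBelow S :=
    ⟨b, fun y hy => le_of_not_gt fun h => (hy.trans (monotone_cdf μ h.le)).not_gt hb⟩
  have hlt : ∀ y < sInf S, cdf μ y < u := fun y hy => not_le.1 fun h => notMem_of_lt_csInf hy hbdd h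
  refine ⟨sInf S, fun y hy => cdf_eq_real μ y ▸ hlt y hy, ?_, ?_⟩
  · have h : μ (Iio (sInf S)) = ENNReal.ofReal (Function.leftLim (cdf μ) (sInf S)) := by
      conv_lhs => rw [← measure_cdf μ]
      rw [StieltjesFunction.measure_Iio _ (tendsto_cdf_atBot μ), sub_zero]
    rw [measureReal_def, h]
    refine ENNReal.toReal_le_of_le_ofReal hu0.le (ENNReal.ofReal_le_ofReal ?_)
    exact le_of_tendsto ((monotone_cdf μ).tendsto_leftLim _)
      (eventually_nhdsWithin_of_forall fun y hy => (hlt y hy).le)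
  · rw [← cdf_eq_real]
    refine ge_of_tendsto (((cdf μ).right_continuous (sInf S)).mono_left
      (nhdsWithin_mono _ Ioi_subset_Ici_self)) (eventually_nhdsWithin_of_forall fun y hy => ?_)
    obtain ⟨z, hz, hzy⟩ := exists_lt_of_csInf_lt hne hy
    exact le_trans hz (monotone_cdf μ hzy.le)

/-- Generalized distributional transform is uniform. Let `Y` be a real random variable on a
probability space `(Ω, P)` with CDF `F(y) = P(Y ≤ y)` and left limit `F(y−) = P(Y < y)`,
and let `V` be uniform on `[0,1]` and independent of `Y`. Then
`U = F(Y−) + V (F(Y) − F(Y−))` is uniformly distributed on `[0,1]`. -/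
theorem gdt_uniform {Ω : Type*} [MeasurableSpace Ω]
    (P : Measure Ω) [IsProbabilityMeasure P]
    (Y V : Ω → ℝ) (hY : Measurable Y) (hV : Measurable V)
    (hVunif : P.map V = volume.restrict (Set.Icc (0 : ℝ) 1))
    (hindep : IndepFun Y V P)
    (F Fminus : ℝ → ℝ)
    (hF : F = fun y => (P (Y ⁻¹' Set.Iic y)).toReal)
    (hFminus : Fminus = fun y => (P (Y ⁻¹' Set.Iio y)).toReal)
    (U : Ω → ℝ)
    (hU : U = fun ω => Fminus (Y ω) + V ω * (F (Y ω) - Fminus (Y ω))) :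
    P.map U = volume.restrict (Set.Icc (0 : ℝ) 1) := by
  have hF' : ∀ y, F y = P.real (Y ⁻¹' Set.Iic y) := fun y => by rw [hF]; rfl
  have hFm' : ∀ y, Fminus y = P.real (Y ⁻¹' Set.Iio y) := fun y => by rw [hFminus]; rfl
  have hFmono : Monotone F := fun a b hab => by
    rw [hF', hF']
    exact measureReal_mono (Set.preimage_mono (Set.Iic_subset_Iic.2 hab))
  have hFmmono : Monotone Fminus := fun a b hab => by
    rw [hFm', hFm']
    exact measureReal_mono (Set.preimage_mono (Set.Iio_subset_Iio hab))
  have hle : ∀ y, Fminus y ≤ F y := fun y => by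
    rw [hF', hFm']
    exact measureReal_mono (Set.preimage_mono Set.Iio_subset_Iic_self)
  have hlt_le : ∀ {a b}, a < b → F a ≤ Fminus b := fun {a b} hab => by
    rw [hF', hFm']
    exact measureReal_mono (Set.preimage_mono (Set.Iic_subset_Iio.2 hab))
  have hFm0 : ∀ y, 0 ≤ Fminus y := fun y => by rw [hFm']; exact measureReal_nonneg
  have hF1 : ∀ y, F y ≤ 1 := fun y => by rw [hF']; exact measureReal_le_one
  have hUm : Measurable U := by
    rw [hU]
    exact (hFmmono.measurable.comp hY).add
      (hV.mul ((hFmono.measurable.comp hY).sub (hFmmono.measurable.comp hY)))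
  have hV01 : ∀ᵐ ω ∂P, V ω ∈ Set.Icc (0 : ℝ) 1 := by
    refine ae_of_ae_map hV.aemeasurable ?_
    rw [hVunif]
    exact ae_restrict_mem measurableSet_Icc
  have hUle : ∀ᵐ ω ∂P, Fminus (Y ω) ≤ U ω ∧ U ω ≤ F (Y ω) := by
    filter_upwards [hV01] with ω hω
    have := hle (Y ω)
    rw [hU]
    constructor <;> nlinarith [hω.1, hω.2]
  have hVcdf : ∀ t ∈ Set.Icc (0 : ℝ) 1, P.real (V ⁻¹' Set.Iic t) = t := fun t ht => by
    rw [measureReal_def, ← Measure.map_apply hV measurableSet_Iic, hVunif,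
      Measure.restrict_apply measurableSet_Iic, Set.inter_comm, ← Set.Ici_inter_Iic,
      Set.inter_assoc, Set.Iic_inter_Iic, min_eq_right ht.2, Set.Ici_inter_Iic, Real.volume_Icc,
      sub_zero, ENNReal.toReal_ofReal ht.1]
  have hkey : ∀ u, 0 < u → u < 1 →
      P.real (U ⁻¹' Set.Iio u) ≤ u ∧ u ≤ P.real (U ⁻¹' Set.Iic u) := by
    intro u hu0 hu1
    have : IsProbabilityMeasure (P.map Y) := Measure.isProbabilityMeasure_map hY.aemeasurable
    obtain ⟨q, hq, hq1, hq2⟩ := exists_quantile (P.map Y) hu0 hu1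
    simp only [map_measureReal_apply hY measurableSet_Iic,
      map_measureReal_apply hY measurableSet_Iio, ← hF', ← hFm'] at hq hq1 hq2
    have hatom : P.real (Y ⁻¹' {q}) = F q - Fminus q := by
      rw [hF', hFm', ← Set.Iio_union_right, Set.preimage_union,
        measureReal_union (Disjoint.preimage _ (by simp)) (hY (measurableSet_singleton q))]
      ring
    set B : Set Ω := {ω | V ω * (F q - Fminus q) ≤ u - Fminus q} with hB
    have hBm : MeasurableSet B := measurableSet_le (hV.mul_const _) measurable_const
    have hA : P.real (Y ⁻¹' Set.Iio q ∪ Y ⁻¹' {q} ∩ B) = u := by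
      rw [measureReal_union
        (Disjoint.mono_right Set.inter_subset_left (Disjoint.preimage _ (by simp)))
        ((hY (measurableSet_singleton q)).inter hBm), ← hFm']
      rcases (hle q).eq_or_lt with h | h
      · have : P.real (Y ⁻¹' {q} ∩ B) ≤ 0 := by
          refine (measureReal_mono Set.inter_subset_left).trans ?_
          rw [hatom]; linarith
        linarith [measureReal_nonneg (μ := P) (s := Y ⁻¹' {q} ∩ B)]
      · have hp : 0 < F q - Fminus q := sub_pos.2 h
        have hBV : B = V ⁻¹' Set.Iic ((u - Fminus q) / (F q - Fminus q)) := by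
          ext ω
          simp [hB, le_div_iff₀ hp]
        rw [hBV, measureReal_def, hindep.measure_inter_preimage_eq_mul _ _
          (measurableSet_singleton q) measurableSet_Iic, ENNReal.toReal_mul, ← measureReal_def,
          ← measureReal_def, hatom, hVcdf _ ⟨div_nonneg (by linarith) hp.le,
            (div_le_one hp).2 (by linarith)⟩]
        field_simp
        ring
    constructor
    · refine (ENNReal.toReal_mono (measure_ne_top _ _) (measure_mono_ae ?_)).trans hA.le
      filter_upwards [hUle] with ω hω hωu
      have hωu : U ω < u := hωu
      rcases lt_trichotomy (Y ω) q with h | h | h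
      · exact Or.inl h
      · refine Or.inr ⟨h, ?_⟩
        simp only [hU, h] at hωu
        change V ω * (F q - Fminus q) ≤ u - Fminus q
        linarith
      · linarith [hlt_le h, hω.1]
    · refine hA.ge.trans (ENNReal.toReal_mono (measure_ne_top _ _) (measure_mono_ae ?_))
      filter_upwards [hUle] with ω hω hωA
      change U ω ≤ u
      rcases hωA with h | ⟨h, hb⟩
      · exact hω.2.trans (hq _ h).le
      · have h : Y ω = q := h
        have hb : V ω * (F q - Fminus q) ≤ u - Fminus q := hb
        simp only [hU, h]
        linarith
  have : IsProbabilityMeasure (P.map U) := Measure.isProbabilityMeasure_map hUm.aemeasurable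
  refine Measure.ext_of_Iic _ _ fun u => ?_
  rw [Measure.map_apply hUm measurableSet_Iic, Measure.restrict_apply measurableSet_Iic,
    Set.inter_comm, ← Set.Ici_inter_Iic, Set.inter_assoc, Set.Iic_inter_Iic, Set.Ici_inter_Iic,
    Real.volume_Icc, sub_zero]
  rcases lt_or_ge u 0 with h0 | h0
  · rw [ENNReal.ofReal_of_nonpos ((min_le_right _ _).trans h0.le)]
    refine measure_eq_zero_iff_ae_notMem.2 ?_
    filter_upwards [hUle] with ω hω hωu
    have hωu : U ω ≤ u := hωu
    linarith [hFm0 (Y ω), hω.1]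
  rcases le_or_gt 1 u with h1 | h1
  · rw [min_eq_left h1, ENNReal.ofReal_one, ← mem_ae_iff_prob_eq_one (hUm measurableSet_Iic)]
    filter_upwards [hUle] with ω hω
    exact (hω.2.trans (hF1 _)).trans h1
  rw [min_eq_right h1.le, ← ofReal_measureReal]
  congr 1
  refine le_antisymm (le_of_forall_gt_imp_ge_of_dense fun w hw => ?_) ?_
  · rcases lt_or_ge w 1 with hw1 | hw1
    · exact (measureReal_mono (Set.preimage_mono (Set.Iic_subset_Iio.2 hw))).trans
        (hkey w (h0.trans_lt hw) hw1).1
    · exact measureReal_le_one.trans hw1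
  · rcases h0.eq_or_lt with h | h
    · exact h ▸ measureReal_nonneg
    · exact (hkey u h h1).2
end

section
/- Let Y be a real-valued random variable on a probability space (Ω, P) with cumulative distribution function F, let V be uniform on [0,1] and independent of Y, and let U = F(Y−) + V·(F(Y) − F(Y−)) be the generalized distributional transform of Y. Then Y = F⁻¹(U) almost surely, where F⁻¹(t) = inf{y ∈ ℝ : F(y) ≥ t}. -/
open MeasureTheory ProbabilityTheory

/-- Almost every point `x` has no null interval `(y, x]` to its left. -/
theorem ae_forall_lt_measure_Ioc_ne_zero (μ : Measure ℝ) :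
    ∀ᵐ x ∂μ, ∀ y < x, μ (Set.Ioc y x) ≠ 0 := by
  have null (q : ℝ) : μ {x | q < x ∧ μ (Set.Ioc q x) = 0} = 0 := by
    refine measure_null_of_locally_null _ fun x hx => ?_
    by_cases h : ∃ z, x < z ∧ μ (Set.Ioc q z) = 0
    · obtain ⟨z, hxz, hz⟩ := h
      exact ⟨_, mem_nhdsWithin_of_mem_nhds (Ioc_mem_nhds hx.1 hxz), hz⟩
    · push Not at h
      refine ⟨_, self_mem_nhdsWithin, measure_mono_null (fun w hw => ?_) hx.2⟩
      exact ⟨hw.1, not_lt.1 fun hxw => h w hxw hw.2⟩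
  have key : ∀ᵐ x ∂μ, ∀ q : ℚ, ¬ ((q : ℝ) < x ∧ μ (Set.Ioc (q : ℝ) x) = 0) :=
    ae_all_iff.2 fun q => by simpa only [ae_iff, not_not] using null q
  filter_upwards [key] with x hx y hy h0
  obtain ⟨q, hyq, hqx⟩ := exists_rat_btwn hy
  exact hx q ⟨hqx, measure_mono_null (Set.Ioc_subset_Ioc_left hyq.le) h0⟩

/-- Quantile-transform recovery. Let `Y` be a real random variable on a probability space
`(Ω, P)` with CDF `F(y) = P(Y ≤ y)` and left limit `F(y−) = P(Y < y)`, let `V` be uniform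
on `[0,1]` independent of `Y`, and let `U = F(Y−) + V (F(Y) − F(Y−))` be the generalized
distributional transform of `Y`. Then `Y = F⁻¹(U)` almost surely, where
`F⁻¹(t) = inf{y : F(y) ≥ t}`. -/
theorem gdt_quantile_recovery {Ω : Type*} [MeasurableSpace Ω]
    (P : Measure Ω) [IsProbabilityMeasure P]
    (Y V : Ω → ℝ) (hY : Measurable Y) (hV : Measurable V)
    (hVunif : P.map V = volume.restrict (Set.Icc (0 : ℝ) 1))
    (hindep : IndepFun Y V P)
    (F Fminus : ℝ → ℝ)
    (hF : F = fun y => (P (Y ⁻¹' Set.Iic y)).toReal)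
    (hFminus : Fminus = fun y => (P (Y ⁻¹' Set.Iio y)).toReal)
    (U : Ω → ℝ)
    (hU : U = fun ω => Fminus (Y ω) + V ω * (F (Y ω) - Fminus (Y ω)))
    (Finv : ℝ → ℝ) (hFinv : Finv = fun t => sInf {y : ℝ | t ≤ F y}) :
    ∀ᵐ ω ∂P, Y ω = Finv (U ω) := by
  have hV01 : ∀ᵐ ω ∂P, V ω ∈ Set.Ioc (0 : ℝ) 1 := by
    refine ae_of_ae_map hV.aemeasurable (p := fun v => v ∈ Set.Ioc (0 : ℝ) 1) ?_
    rw [hVunif, ← restrict_Ioc_eq_restrict_Icc]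
    exact ae_restrict_mem measurableSet_Ioc
  filter_upwards [hV01, ae_of_ae_map hY.aemeasurable (ae_forall_lt_measure_Ioc_ne_zero (P.map Y))]
    with ω hv hflat
  have hle : Fminus (Y ω) ≤ F (Y ω) := by
    rw [hF, hFminus]
    exact measureReal_mono (Set.preimage_mono Set.Iio_subset_Iic_self)
  have hlt (y : ℝ) (hy : y < Y ω) : F y < U ω := by
    have hleft : F y ≤ Fminus (Y ω) := by
      rw [hF, hFminus]
      exact measureReal_mono (Set.preimage_mono (Set.Iic_subset_Iio.2 hy))
    have hstrict : F y < F (Y ω) := by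
      have hpos : 0 < P.real (Y ⁻¹' Set.Ioc y (Y ω)) := by
        have := hflat y hy
        rw [Measure.map_apply hY measurableSet_Ioc] at this
        exact ENNReal.toReal_pos this (measure_ne_top _ _)
      have hadd : P.real (Y ⁻¹' Set.Iic (Y ω)) =
          P.real (Y ⁻¹' Set.Iic y) + P.real (Y ⁻¹' Set.Ioc y (Y ω)) := by
        rw [← Set.Iic_union_Ioc_eq_Iic hy.le, Set.preimage_union]
        refine measureReal_union ?_ (hY measurableSet_Ioc)
        exact (Set.Iic_disjoint_Ioc le_rfl).preimage Y
      rw [hF]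
      change P.real _ < P.real _
      linarith
    rw [hU]
    change F y < Fminus (Y ω) + V ω * (F (Y ω) - Fminus (Y ω))
    rcases hle.eq_or_lt with h | h
    · rw [h]
      simpa using hstrict
    · nlinarith [mul_pos hv.1 (sub_pos.2 h)]
  have hUF : U ω ≤ F (Y ω) := by
    rw [hU]
    nlinarith [mul_nonneg (sub_nonneg.2 hv.2) (sub_nonneg.2 hle)]
  have hleast : IsLeast {y : ℝ | U ω ≤ F y} (Y ω) :=
    ⟨hUF, fun y hy => not_lt.1 fun h => (hlt y h).not_ge hy⟩
  rw [hFinv]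
  exact hleast.csInf_eq.symm
end

section
/- Let Y = (Y_1, …, Y_p) be a random vector on a probability space (Ω, P), with F_i the cumulative distribution function of Y_i, and let V_1, …, V_p be uniform-on-[0,1] random variables each independent of the corresponding Y_i, with U_i = F_i(Y_i−) + V_i·(F_i(Y_i) − F_i(Y_i−)) the generalized distributional transform of Y_i. If Y_i = F_i⁻¹(U_i) almost surely for every i, then the joint distribution function of Y is expressed through the joint distribution of (U_1, …, U_p) evaluated at the marginals: for all y_1, …, y_p ∈ ℝ, P(Y_1 ≤ y_1, …, Y_p ≤ y_p) = P(U_1 ≤ F_1(y_1), …, U_p ≤ F_p(y_p)). -/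
open MeasureTheory ProbabilityTheory

/-- A measure on `ℝ` gives no mass to the set where its distribution function vanishes. -/
theorem ae_measure_Iic_ne_zero (ν : Measure ℝ) : ∀ᵐ x ∂ν, ν (Set.Iic x) ≠ 0 := by
  rw [ae_iff]
  refine measure_null_of_locally_null _ fun x hx => ?_
  have hx0 : ν (Set.Iic x) = 0 := by simpa using hx
  by_cases h : ∃ z, x < z ∧ ν (Set.Iic z) = 0
  · obtain ⟨z, hxz, hz⟩ := h
    exact ⟨_, mem_nhdsWithin_of_mem_nhds (Iic_mem_nhds hxz), hz⟩
  · push Not at h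
    refine ⟨_, Filter.mem_of_superset self_mem_nhdsWithin fun z hz => ?_, hx0⟩
    by_contra hzx
    exact h z (not_le.mp hzx) (by simpa using hz)

/-- The superlevel sets of a distribution function at positive levels are bounded below. -/
theorem bddBelow_setOf_le_cdf (ν : Measure ℝ) {t : ℝ} (ht : 0 < t) :
    BddBelow {z : ℝ | t ≤ cdf ν z} := by
  obtain ⟨a, ha⟩ := ((tendsto_cdf_atBot ν).eventually (gt_mem_nhds ht)).exists
  refine ⟨a, fun z (hz : t ≤ cdf ν z) => ?_⟩
  by_contra hza
  exact absurd (hz.trans (monotone_cdf ν (not_le.mp hza).le)) (not_le.mpr ha)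

/-- A random variable that is uniform on `[0, 1]` almost surely takes values in `(0, 1]`. -/
theorem ae_mem_Ioc_of_map_eq_restrict_Icc {Ω : Type*} [MeasurableSpace Ω] {P : Measure Ω}
    {V : Ω → ℝ} (hV : Measurable V)
    (hVunif : P.map V = volume.restrict (Set.Icc (0 : ℝ) 1)) :
    ∀ᵐ ω ∂P, V ω ∈ Set.Ioc (0 : ℝ) 1 := by
  refine ae_of_ae_map hV.aemeasurable ?_
  rw [hVunif, ← restrict_Ioc_eq_restrict_Icc]
  exact ae_restrict_mem measurableSet_Ioc

/-- Copula representation of the joint distribution. Let `Y = (Y_1, …, Y_p)` be a random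
vector on `(Ω, P)` with marginal CDFs `F_i(y) = P(Y_i ≤ y)`, let `V_i` be uniform on
`[0,1]` and independent of `Y_i`, and let
`U_i = F_i(Y_i−) + V_i (F_i(Y_i) − F_i(Y_i−))` be the generalized distributional transform
of `Y_i`. If `Y_i = F_i⁻¹(U_i)` almost surely for every `i` (with
`F_i⁻¹(t) = inf{y : F_i(y) ≥ t}`), then for all `y_1, …, y_p`,
`P(Y_1 ≤ y_1, …, Y_p ≤ y_p) = P(U_1 ≤ F_1(y_1), …, U_p ≤ F_p(y_p))`. -/
theorem joint_cdf_via_copula {Ω : Type*} [MeasurableSpace Ω]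
    (P : Measure Ω) [IsProbabilityMeasure P] (p : ℕ)
    (Y V : Fin p → Ω → ℝ)
    (hY : ∀ i, Measurable (Y i)) (hV : ∀ i, Measurable (V i))
    (hVunif : ∀ i, P.map (V i) = volume.restrict (Set.Icc (0 : ℝ) 1))
    (hindep : ∀ i, IndepFun (Y i) (V i) P)
    (F Fminus : Fin p → ℝ → ℝ)
    (hF : ∀ i, F i = fun y => (P (Y i ⁻¹' Set.Iic y)).toReal)
    (hFminus : ∀ i, Fminus i = fun y => (P (Y i ⁻¹' Set.Iio y)).toReal)
    (U : Fin p → Ω → ℝ)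
    (hU : ∀ i, U i = fun ω =>
      Fminus i (Y i ω) + V i ω * (F i (Y i ω) - Fminus i (Y i ω)))
    (Finv : Fin p → ℝ → ℝ)
    (hFinv : ∀ i, Finv i = fun t => sInf {y : ℝ | t ≤ F i y})
    (hrecover : ∀ i, ∀ᵐ ω ∂P, Y i ω = Finv i (U i ω))
    (y : Fin p → ℝ) :
    P {ω | ∀ i, Y i ω ≤ y i} = P {ω | ∀ i, U i ω ≤ F i (y i)} := by
  have hcdf (i z) : F i z = cdf (P.map (Y i)) z := by
    have := Measure.isProbabilityMeasure_map (μ := P) (hY i).aemeasurable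
    rw [cdf_eq_real, hF, Measure.real, Measure.map_apply (hY i) measurableSet_Iic]
  have hmono (i) : Monotone (F i) := fun a b hab => by
    simpa only [hcdf] using monotone_cdf _ hab
  have key (i) : ∀ᵐ ω ∂P, Y i ω ≤ y i ↔ U i ω ≤ F i (y i) := by
    filter_upwards [hrecover i, ae_mem_Ioc_of_map_eq_restrict_Icc (hV i) (hVunif i),
      ae_of_ae_map (hY i).aemeasurable (ae_measure_Iic_ne_zero (P.map (Y i)))]
      with ω hrec ⟨hV0, hV1⟩ hne
    rw [Measure.map_apply (hY i) measurableSet_Iic] at hne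
    have hpos : 0 < F i (Y i ω) := by
      rw [hF]
      exact ENNReal.toReal_pos hne (measure_ne_top _ _)
    have hminus_nonneg : 0 ≤ Fminus i (Y i ω) := by
      rw [hFminus]
      exact ENNReal.toReal_nonneg
    have hminus_le : Fminus i (Y i ω) ≤ F i (Y i ω) := by
      rw [hF, hFminus]
      exact ENNReal.toReal_mono (measure_ne_top _ _)
        (measure_mono (Set.preimage_mono Set.Iio_subset_Iic_self))
    have hUω : U i ω = Fminus i (Y i ω) + V i ω * (F i (Y i ω) - Fminus i (Y i ω)) := by
      rw [hU]
    constructor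
    · intro h
      have := hmono i h
      nlinarith
    · intro h
      have hUpos : 0 < U i ω := by
        nlinarith [mul_pos hV0 hpos, mul_nonneg (sub_nonneg.mpr hV1) hminus_nonneg]
      rw [hrec, hFinv]
      refine csInf_le ?_ h
      simpa only [hcdf] using bddBelow_setOf_le_cdf (P.map (Y i)) hUpos
  refine measure_congr ?_
  filter_upwards [ae_all_iff.mpr key] with ω hω
  exact propext (forall_congr' hω)
end
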